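/- Let P be a probability distribution on a finite set that is not a uniform distribution (so V(P) > 0), with H and V computed with logarithm base 2, and let b ∈ ℝ. Then lim_{n→∞} F^D(U_2^n → P^{⌊H(P)^{−1}n + b√n⌋}) = lim_{n→∞} F^M(U_2^n → P^{⌊H(P)^{−1}n + b√n⌋}) = √(G(−H(P)^{3/2} b / √V(P))). -/

import Mathlib

open MeasureTheory Filter

namespace RNG

variable {α β : Type*}

/-- `P` is a probability distribution on the finite set `α`. -/
def IsProb [Fintype α] (P : α → ℝ) : Prop :=
  (∀ x, 0 ≤ P x) ∧ ∑ x, P x = 1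

open Classical in
/-- Pushforward distribution `W(P)(y) = ∑_{x : W x = y} P x`. -/
noncomputable def push [Fintype α] (W : α → β) (P : α → ℝ) : β → ℝ :=
  fun y => ∑ x, if W x = y then P x else 0

/-- Fidelity (Bhattacharyya coefficient) between distributions on the same finite set. -/
noncomputable def fid [Fintype β] (R S : β → ℝ) : ℝ :=
  ∑ y, Real.sqrt (R y * S y)

/-- Sum of the `l` largest values of `P`, i.e. the `l`-th partial sum of the
decreasing rearrangement of `P` (padded with zeros). -/
noncomputable def topSum [Fintype α] (P : α → ℝ) (l : ℕ) : ℝ :=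
  sSup {s : ℝ | ∃ A : Finset α, A.card ≤ l ∧ s = ∑ x ∈ A, P x}

/-- Majorization `P ≺ P'` (the distributions may live on different finite sets). -/
def Maj [Fintype α] [Fintype β] (P : α → ℝ) (P' : β → ℝ) : Prop :=
  ∀ l : ℕ, topSum P l ≤ topSum P' l

/-- Maximal fidelity under deterministic transformations,
`F^D(P → Q) = max {F(W(P), Q) | W : α → β}`. -/
noncomputable def FD [Fintype α] [Fintype β] (P : α → ℝ) (Q : β → ℝ) : ℝ :=
  sSup {r : ℝ | ∃ W : α → β, r = fid (push W P) Q}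

/-- Maximal fidelity under the majorization condition,
`F^M(P → Q) = max {F(P', Q) | P ≺ P', P'` a distribution on the target set`}`. -/
noncomputable def FM [Fintype α] [Fintype β] (P : α → ℝ) (Q : β → ℝ) : ℝ :=
  sSup {r : ℝ | ∃ P' : β → ℝ, IsProb P' ∧ Maj P P' ∧ r = fid P' Q}

/-- Shannon entropy (natural logarithm). -/
noncomputable def H [Fintype α] (P : α → ℝ) : ℝ := ∑ x, -(P x * Real.log (P x))

/-- Varentropy `V(P)` (natural logarithm). -/
noncomputable def V [Fintype α] (P : α → ℝ) : ℝ :=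
  ∑ x, P x * (-Real.log (P x) - H P) ^ 2

/-- Shannon entropy, base-2 logarithm. -/
noncomputable def H2 [Fintype α] (P : α → ℝ) : ℝ := ∑ x, -(P x * Real.logb 2 (P x))

/-- Varentropy, base-2 logarithm. -/
noncomputable def V2 [Fintype α] (P : α → ℝ) : ℝ :=
  ∑ x, P x * (-Real.logb 2 (P x) - H2 P) ^ 2

/-- The `n`-fold i.i.d. product distribution `P^n`. -/
noncomputable def iid [Fintype α] (P : α → ℝ) (n : ℕ) : (Fin n → α) → ℝ :=
  fun f => ∏ i, P (f i)

/-- The uniform distribution on a two-element set. -/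
noncomputable def U2 : Fin 2 → ℝ := fun _ => 1 / 2

/-- Density of the normal distribution `N(m, v)`. -/
noncomputable def normalPDF (m v t : ℝ) : ℝ :=
  (Real.sqrt (2 * Real.pi * v))⁻¹ * Real.exp (-(t - m) ^ 2 / (2 * v))

/-- Standard normal cumulative distribution function `G`. -/
noncomputable def stdG (x : ℝ) : ℝ := ∫ t in Set.Iic x, normalPDF 0 1 t

/-- Density `N_P` of `N(0, V(P))`. -/
noncomputable def NP [Fintype α] (P : α → ℝ) (x : ℝ) : ℝ := normalPDF 0 (V P) x

/-- Density `N_{P,Q,b}` of `N(H(Q)b, (H(P)/H(Q))·V(Q))`. -/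
noncomputable def NPQ [Fintype α] [Fintype β] (P : α → ℝ) (Q : β → ℝ) (b x : ℝ) : ℝ :=
  normalPDF (H Q * b) (H P / H Q * V Q) x

/-- Cdf `G_P(x) = G(x/√V(P))`. -/
noncomputable def GP [Fintype α] (P : α → ℝ) (x : ℝ) : ℝ := stdG (x / Real.sqrt (V P))

/-- Cdf `G_{P,Q,b}(x) = G(√(H(Q)/(H(P)V(Q)))·(x − H(Q)b))`. -/
noncomputable def GPQ [Fintype α] [Fintype β] (P : α → ℝ) (Q : β → ℝ) (b x : ℝ) : ℝ :=
  stdG (Real.sqrt (H Q / (H P * V Q)) * (x - H Q * b))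

/-- `I_{P,Q,b}(x) = ∫_{−∞}^x √(N_P(t) N_{P,Q,b}(t)) dt`. -/
noncomputable def IPQ [Fintype α] [Fintype β] (P : α → ℝ) (Q : β → ℝ) (b x : ℝ) : ℝ :=
  ∫ t in Set.Iic x, Real.sqrt (NP P t * NPQ P Q b t)

/-- `I_{P,Q,b}(∞) = ∫_ℝ √(N_P(t) N_{P,Q,b}(t)) dt`. -/
noncomputable def IPQinf [Fintype α] [Fintype β] (P : α → ℝ) (Q : β → ℝ) (b : ℝ) : ℝ :=
  ∫ t : ℝ, Real.sqrt (NP P t * NPQ P Q b t)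

/-- `L^D_n(P,Q|ν)`: the maximal `L` with `F^D(P^n → Q^L) ≥ ν`. -/
noncomputable def LD [Fintype α] [Fintype β] (P : α → ℝ) (Q : β → ℝ) (ν : ℝ) (n : ℕ) : ℕ :=
  sSup {L : ℕ | ν ≤ FD (iid P n) (iid Q L)}

/-- The optimal second order rate `R^D_2(P,Q|ν)`. -/
noncomputable def RD2 [Fintype α] [Fintype β] (P : α → ℝ) (Q : β → ℝ) (ν : ℝ) : ℝ :=
  sSup {b : ℝ | ∃ c : ℝ, ν ≤ c ∧
    Tendsto (fun n : ℕ =>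
      FD (iid P n) (iid Q (⌊H P / H Q * n + b * Real.sqrt n⌋₊))) atTop (nhds c)}

open ProbabilityTheory Topology

lemma stdG_eq_gaussianReal (x : ℝ) : stdG x = (gaussianReal 0 1).real (Set.Iic x) := by
  rw [measureReal_def, gaussianReal_apply_eq_integral 0 one_ne_zero,
    ENNReal.toReal_ofReal (integral_nonneg fun t => gaussianPDFReal_nonneg 0 1 t)]
  simp [stdG, normalPDF, gaussianPDFReal]

lemma iid_isProb [Fintype α] {P : α → ℝ} (hP : IsProb P) (n : ℕ) : IsProb (iid P n) := by
  classical
  refine ⟨fun f => Finset.prod_nonneg fun i _ => hP.1 _, ?_⟩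
  have h := Finset.prod_univ_sum (fun _ : Fin n => (Finset.univ : Finset α)) (fun _ x => P x)
  simp only [hP.2, Finset.prod_const_one, Fintype.piFinset_univ] at h
  exact h.symm

/-- The probability mass function associated with `P`. -/
noncomputable def toPMF [Fintype α] {P : α → ℝ} (hP : IsProb P) : PMF α :=
  PMF.ofFintype (fun x => ENNReal.ofReal (P x)) (by
    rw [← ENNReal.ofReal_sum_of_nonneg fun x _ => hP.1 x, hP.2, ENNReal.ofReal_one])

lemma integral_toPMF [Fintype α] [MeasurableSpace α] [DiscreteMeasurableSpace α] {P : α → ℝ}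
    (hP : IsProb P) (f : α → ℝ) : ∫ x, f x ∂(toPMF hP).toMeasure = ∑ x, P x * f x := by
  rw [PMF.integral_eq_sum]
  simp [toPMF, hP.1]

open Classical in
lemma infinitePi_real_prefix [Fintype α] [MeasurableSpace α] [DiscreteMeasurableSpace α]
    {P : α → ℝ} (hP : IsProb P) (n : ℕ) (E : Set (Fin n → α)) :
    (Measure.infinitePi fun _ : ℕ => (toPMF hP).toMeasure).real
      {ω | (fun i : Fin n => ω i) ∈ E} = ∑ f, if f ∈ E then iid P n f else 0 := by
  have hmap := Measure.map_infinitePi_infinitePi_of_inj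
    (P := fun _ : ℕ => (toPMF hP).toMeasure) (f := fun i : Fin n => (i : ℕ)) Fin.val_injective
  rw [Measure.infinitePi_eq_pi (ι := Fin n)] at hmap
  have hE : MeasurableSet E := E.toFinite.measurableSet
  have hm : Measurable fun (ω : ℕ → α) (i : Fin n) => ω i := by fun_prop
  have h1 : (Measure.infinitePi fun _ : ℕ => (toPMF hP).toMeasure).real
      {ω | (fun i : Fin n => ω i) ∈ E} =
      (Measure.pi fun _ : Fin n => (toPMF hP).toMeasure).real E := by
    rw [← hmap, map_measureReal_apply hm hE]
    rfl
  rw [h1, ← Finset.sum_filter]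
  have h2 : E = ↑(Finset.univ.filter fun f : Fin n → α => f ∈ E) := by ext; simp
  conv_lhs => rw [h2]
  rw [← sum_measureReal_singleton]
  refine Finset.sum_congr rfl fun f _ => ?_
  rw [measureReal_def, Measure.pi_singleton, ENNReal.toReal_prod]
  refine Finset.prod_congr rfl fun i _ => ?_
  rw [PMF.toMeasure_apply_singleton _ _ (measurableSet_singleton _)]
  simp [toPMF, hP.1]

open Classical in
/-- Central limit theorem for finite i.i.d. products, along varying sample sizes and varying
thresholds. -/
lemma tendsto_iid_sum_le [Fintype α] {P : α → ℝ} (hP : IsProb P) {φ : α → ℝ}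
    (h0 : ∑ x, P x * φ x = 0) (h1 : ∑ x, P x * φ x ^ 2 = 1) {L : ℕ → ℕ}
    (hL : Tendsto L atTop atTop) {t : ℕ → ℝ} {τ : ℝ} (ht : Tendsto t atTop (𝓝 τ)) :
    Tendsto (fun n => ∑ f : Fin (L n) → α,
      if (Real.sqrt (L n))⁻¹ * ∑ i, φ (f i) ≤ t n then iid P (L n) f else 0)
      atTop (𝓝 (stdG τ)) := by
  let _ : MeasurableSpace α := ⊤
  have : DiscreteMeasurableSpace α := ⟨fun _ => trivial⟩
  set μ := Measure.infinitePi fun _ : ℕ => (toPMF hP).toMeasure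
  have hφ : Measurable φ := measurable_of_finite φ
  have hlaw (i : ℕ) : μ.map (fun ω => φ (ω i)) = (toPMF hP).toMeasure.map φ := by
    rw [← Measure.infinitePi_map_eval (fun _ : ℕ => (toPMF hP).toMeasure) i,
      Measure.map_map hφ (by fun_prop)]
    rfl
  have hint (g : α → ℝ) : ∫ ω, g (ω 0) ∂μ = ∑ x, P x * g x := by
    have hg : Measurable g := measurable_of_finite g
    rw [← integral_toPMF hP, ← Measure.infinitePi_map_eval (fun _ : ℕ => (toPMF hP).toMeasure) 0,
      integral_map (measurable_pi_apply 0).aemeasurable hg.aestronglyMeasurable]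
  have hclt : TendstoInDistribution
      (fun (n : ℕ) (ω : ℕ → α) => (Real.sqrt n)⁻¹ * ∑ k ∈ Finset.range n, φ (ω k))
      atTop (id : ℝ → ℝ) (fun _ => μ) (gaussianReal 0 1) := by
    refine tendstoInDistribution_inv_sqrt_mul_sum (X := fun (k : ℕ) (ω : ℕ → α) => φ (ω k)) HasLaw.id ?_ ?_ ?_ ?_
    · exact (hint φ).trans h0
    · exact (hint (fun x => φ x ^ 2)).trans h1
    · exact iIndepFun_infinitePi (X := fun _ => φ) fun _ => hφ
    · exact fun i => ⟨(hφ.comp (measurable_pi_apply i)).aemeasurable,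
        (hφ.comp (measurable_pi_apply 0)).aemeasurable, by rw [hlaw, hlaw]⟩
  have hsub : TendstoInDistribution
      (fun (n : ℕ) (ω : ℕ → α) => (Real.sqrt (L n))⁻¹ * ∑ k ∈ Finset.range (L n), φ (ω k))
      atTop (id : ℝ → ℝ) (fun _ => μ) (gaussianReal 0 1) :=
    ⟨fun n => hclt.forall_aemeasurable (L n), hclt.aemeasurable_limit, hclt.tendsto.comp hL⟩
  have hadd := hsub.add_of_tendstoInMeasure_const (Y := fun n _ => - t n) (c := -τ)
    (tendstoInMeasure_of_tendsto_ae (fun n => aestronglyMeasurable_const)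
      (ae_of_all _ fun _ => ht.neg)) (fun n => aemeasurable_const)
  have hmeas := hadd.aemeasurable_limit
  have key := ProbabilityMeasure.tendsto_measure_of_null_frontier_of_tendsto' hadd.tendsto
    (E := Set.Iic 0) (by
      have : NullSingletonClass (gaussianReal 0 1) := nullSingletonClass_gaussianReal one_ne_zero
      rw [frontier_Iic, ProbabilityMeasure.coe_mk, Measure.map_apply_of_aemeasurable hmeas
        (measurableSet_singleton _)]
      have : (fun ω : ℝ => id ω + -τ) ⁻¹' {0} = {τ} := by
        ext x; simp
      rw [this, measure_singleton])
  have key' := (ENNReal.tendsto_toReal (by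
    have := Measure.isProbabilityMeasure_map hmeas
    exact measure_ne_top (Measure.map _ (gaussianReal 0 1)) _)).comp key
  rw [stdG_eq_gaussianReal]
  convert! key' using 2 with n
  · have hn := infinitePi_real_prefix hP (L n)
      {f | (Real.sqrt (L n))⁻¹ * ∑ i, φ (f i) ≤ t n}
    simp only [Set.mem_ofPred_eq] at hn
    rw [← hn, Function.comp_apply, ProbabilityMeasure.coe_mk,
      Measure.map_apply_of_aemeasurable (hadd.forall_aemeasurable n) measurableSet_Iic,
      measureReal_def]
    congr 2
    ext ω
    simp [Finset.sum_range]
  · rw [ProbabilityMeasure.coe_mk, Measure.map_apply_of_aemeasurable hmeas measurableSet_Iic,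
      measureReal_def]
    congr 2
    ext x
    simp

open Classical in
/-- The `Q`-mass of the points whose `Q`-probability is at least `θ`. -/
noncomputable def massAbove [Fintype β] (Q : β → ℝ) (θ : ℝ) : ℝ :=
  ∑ y, if θ ≤ Q y then Q y else 0

/-- The uniform distribution on `α`. -/
noncomputable def unif (α : Type*) [Fintype α] : α → ℝ := fun _ => (Fintype.card α : ℝ)⁻¹

lemma push_isProb [Fintype α] [Fintype β] {P : α → ℝ} (hP : IsProb P) (W : α → β) :
    IsProb (push W P) := by
  classical
  refine ⟨fun y => Finset.sum_nonneg fun x _ => ?_, ?_⟩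
  · split_ifs
    exacts [hP.1 x, le_rfl]
  · unfold push
    rw [Finset.sum_comm]
    simpa using hP.2

lemma finite_topSum_set [Fintype α] (P : α → ℝ) (l : ℕ) :
    {s : ℝ | ∃ A : Finset α, A.card ≤ l ∧ s = ∑ x ∈ A, P x}.Finite :=
  (Set.finite_range fun A : Finset α => ∑ x ∈ A, P x).subset <| by
    rintro _ ⟨A, -, rfl⟩
    exact ⟨A, rfl⟩

lemma sum_le_topSum [Fintype α] (P : α → ℝ) {l : ℕ} {A : Finset α} (hA : A.card ≤ l) :
    ∑ x ∈ A, P x ≤ topSum P l :=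
  le_csSup (finite_topSum_set P l).bddAbove ⟨A, hA, rfl⟩

lemma exists_topSum_eq [Fintype α] (P : α → ℝ) (l : ℕ) :
    ∃ A : Finset α, A.card ≤ l ∧ topSum P l = ∑ x ∈ A, P x :=
  have hne : {s : ℝ | ∃ A : Finset α, A.card ≤ l ∧ s = ∑ x ∈ A, P x}.Nonempty := ⟨0, ∅, by simp⟩
  hne.csSup_mem (finite_topSum_set P l)

lemma maj_push [Fintype α] [Fintype β] {P : α → ℝ} (hP : ∀ x, 0 ≤ P x) (W : α → β) :
    Maj P (push W P) := by
  classical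
  intro l
  obtain ⟨A, hA, h⟩ := exists_topSum_eq P l
  rw [h]
  refine le_trans ?_ (sum_le_topSum _ (Finset.card_image_le.trans hA : (A.image W).card ≤ l))
  unfold push
  rw [Finset.sum_comm, ← Finset.sum_filter_add_sum_filter_not Finset.univ (· ∈ A)]
  refine le_add_of_le_of_nonneg (le_of_eq ?_) (Finset.sum_nonneg fun x _ =>
    Finset.sum_nonneg fun y _ => ?_)
  · rw [Finset.filter_univ_mem]
    refine Finset.sum_congr rfl fun x hx => ?_
    rw [Finset.sum_ite_eq, if_pos (Finset.mem_image_of_mem W hx)]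
  · split_ifs
    exacts [hP x, le_rfl]

lemma fid_nonneg [Fintype β] (R S : β → ℝ) : 0 ≤ fid R S :=
  Finset.sum_nonneg fun _ _ => Real.sqrt_nonneg _

lemma sum_le_massAbove [Fintype β] {Q : β → ℝ} (hQ : ∀ y, 0 ≤ Q y) {θ : ℝ} (hθ : 0 ≤ θ)
    (A : Finset β) : ∑ y ∈ A, Q y ≤ massAbove Q θ + A.card * θ := by
  classical
  calc ∑ y ∈ A, Q y ≤ ∑ y ∈ A, ((if θ ≤ Q y then Q y else 0) + θ) := by
        refine Finset.sum_le_sum fun y _ => ?_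
        split_ifs with h
        · linarith
        · linarith [not_le.1 h]
    _ = ∑ y ∈ A, (if θ ≤ Q y then Q y else 0) + A.card * θ := by
        rw [Finset.sum_add_distrib, Finset.sum_const, nsmul_eq_mul]
    _ ≤ _ := by
        gcongr
        refine Finset.sum_le_univ_sum_of_nonneg fun y => ?_
        split_ifs
        exacts [hQ y, le_rfl]

lemma unif_isProb (α : Type*) [Fintype α] [Nonempty α] : IsProb (unif α) :=
  ⟨fun _ => by unfold unif; positivity, by simp [unif]⟩

/-- A distribution majorizing the uniform distribution on `α` is supported on at most `|α|`
points, whence its fidelity to `Q` is controlled by the upper tail of `Q`. -/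
lemma fid_le_of_maj_unif [Fintype α] [Nonempty α] [Fintype β] {P' Q : β → ℝ} (hP' : IsProb P')
    (hQ : IsProb Q) (hmaj : Maj (unif α) P') {θ : ℝ} (hθ : 0 ≤ θ) :
    fid P' Q ≤ Real.sqrt (massAbove Q θ + Fintype.card α * θ) := by
  classical
  obtain ⟨A, hA, h⟩ := exists_topSum_eq P' (Fintype.card α)
  have h1 : 1 ≤ ∑ y ∈ A, P' y := by
    rw [← h, ← (unif_isProb α).2]
    exact (sum_le_topSum (unif α) Finset.card_univ.le).trans (hmaj _)
  have h0 : ∀ y ∉ A, P' y = 0 := by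
    have h2 := Finset.sum_add_sum_compl A P'
    rw [hP'.2] at h2
    have h3 : ∑ y ∈ Aᶜ, P' y = 0 :=
      le_antisymm (by linarith) (Finset.sum_nonneg fun y _ => hP'.1 y)
    intro y hy
    exact (Finset.sum_eq_zero_iff_of_nonneg fun y _ => hP'.1 y).1 h3 y (by simpa using hy)
  have hA1 : ∑ y ∈ A, P' y ≤ 1 :=
    (Finset.sum_le_univ_sum_of_nonneg hP'.1).trans_eq hP'.2
  calc fid P' Q = ∑ y ∈ A, Real.sqrt (P' y) * Real.sqrt (Q y) := by
        unfold fid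
        rw [← Finset.sum_subset A.subset_univ fun y _ hy => by simp [h0 y hy]]
        exact Finset.sum_congr rfl fun y _ => Real.sqrt_mul (hP'.1 y) _
    _ ≤ Real.sqrt (∑ y ∈ A, P' y) * Real.sqrt (∑ y ∈ A, Q y) :=
        Real.sum_sqrt_mul_sqrt_le A hP'.1 hQ.1
    _ ≤ 1 * Real.sqrt (massAbove Q θ + Fintype.card α * θ) := by
        gcongr
        · exact Real.sqrt_le_one.2 hA1
        · refine (sum_le_massAbove hQ.1 hθ A).trans ?_
          gcongr
    _ = _ := one_mul _

lemma bddAbove_FM_unif [Fintype α] [Nonempty α] [Fintype β] {Q : β → ℝ} (hQ : IsProb Q) :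
    BddAbove {r : ℝ | ∃ P' : β → ℝ, IsProb P' ∧ Maj (unif α) P' ∧ r = fid P' Q} :=
  ⟨_, fun _ ⟨_, hP', hmaj, h⟩ => h.trans_le (fid_le_of_maj_unif hP' hQ hmaj le_rfl)⟩

lemma FM_unif_le [Fintype α] [Nonempty α] [Fintype β] {Q : β → ℝ} (hQ : IsProb Q) {θ : ℝ}
    (hθ : 0 ≤ θ) :
    FM (unif α) Q ≤ Real.sqrt (massAbove Q θ + Fintype.card α * θ) :=
  Real.sSup_le (fun _ ⟨_, hP', hmaj, h⟩ => h.trans_le (fid_le_of_maj_unif hP' hQ hmaj hθ))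
    (Real.sqrt_nonneg _)

lemma FD_unif_le_FM [Fintype α] [Nonempty α] [Fintype β] {Q : β → ℝ} (hQ : IsProb Q) :
    FD (unif α) Q ≤ FM (unif α) Q := by
  refine Real.sSup_le ?_ (Real.sSup_nonneg fun _ ⟨_, _, _, h⟩ => h ▸ fid_nonneg _ _)
  rintro _ ⟨W, rfl⟩
  exact le_csSup (bddAbove_FM_unif hQ)
    ⟨_, push_isProb (unif_isProb α) W, maj_push (unif_isProb α).1 W, rfl⟩

lemma fid_push_le_FD [Fintype α] [Fintype β] (P : α → ℝ) (Q : β → ℝ) (W : α → β) :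
    fid (push W P) Q ≤ FD P Q := by
  refine le_csSup ?_ ⟨W, rfl⟩
  have hfin : (Set.range fun W : α → β => fid (push W P) Q).Finite := Set.finite_range _
  refine (hfin.subset ?_).bddAbove
  rintro _ ⟨W₁, rfl⟩
  exact ⟨W₁, rfl⟩

/-- Prescribed lower bounds on fibre sizes can be realized when their sum is at most `|α|`. -/
lemma exists_map_le_push_unif [Fintype α] [Fintype β] [Nonempty β] (k : β → ℕ)
    (hk : ∑ y, k y ≤ Fintype.card α) :
    ∃ W : α → β, ∀ y, k y * (Fintype.card α : ℝ)⁻¹ ≤ push W (unif α) y := by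
  classical
  obtain ⟨e⟩ := Function.Embedding.nonempty_of_card_le (α := Σ y, Fin (k y)) (β := α)
    (by simpa using hk)
  refine ⟨Function.extend e Sigma.fst fun _ => Classical.arbitrary β, fun y => ?_⟩
  unfold push unif
  rw [← Finset.sum_filter, Finset.sum_const, nsmul_eq_mul]
  gcongr
  calc k y = (Finset.univ.map ((Function.Embedding.sigmaMk y).trans e)).card := by simp
    _ ≤ _ := by
      refine Finset.card_le_card fun a ha => ?_
      obtain ⟨j, -, rfl⟩ := Finset.mem_map.1 ha
      simp [e.injective.extend_apply]

lemma le_FD_unif [Fintype α] [Nonempty α] [Fintype β] {Q : β → ℝ} (hQ : IsProb Q) {s : ℝ}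
    (hs : 1 ≤ s) :
    Real.sqrt ((1 - s⁻¹) * massAbove Q (s / Fintype.card α)) ≤ FD (unif α) Q := by
  classical
  have : Nonempty β := by
    by_contra h
    rw [not_nonempty_iff] at h
    simpa using hQ.2
  have hs0 : 0 < s := by linarith
  have hM : (0 : ℝ) < Fintype.card α := by exact_mod_cast Fintype.card_pos
  set M := (Fintype.card α : ℝ)
  set m := massAbove Q (s / M) with hm
  have hle (y : β) : (if s / M ≤ Q y then Q y else 0) ≤ Q y := by
    split_ifs
    exacts [le_rfl, hQ.1 y]
  have hnn (y : β) : 0 ≤ (if s / M ≤ Q y then Q y else 0) := by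
    split_ifs
    exacts [hQ.1 y, le_rfl]
  have hm0 : 0 ≤ m := Finset.sum_nonneg fun y _ => hnn y
  have hm1 : m ≤ 1 := (Finset.sum_le_sum fun y _ => hle y).trans_eq hQ.2
  have hr : 0 ≤ 1 - s⁻¹ := by linarith [inv_le_one_of_one_le₀ hs]
  rcases hm0.eq_or_lt with hm' | hmpos
  · rw [← hm', mul_zero, Real.sqrt_zero]
    exact (fid_nonneg _ _).trans (fid_push_le_FD (unif α) Q fun _ => Classical.arbitrary β)
  let q : β → ℝ := fun y => if s / M ≤ Q y then Q y else 0
  obtain ⟨W, hW⟩ := exists_map_le_push_unif (α := α) (fun y => ⌊M * q y / m⌋₊) (by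
    have h : ∑ y, (⌊M * q y / m⌋₊ : ℝ) ≤ M := by
      calc ∑ y, (⌊M * q y / m⌋₊ : ℝ) ≤ ∑ y, M * q y / m :=
            Finset.sum_le_sum fun y _ => Nat.floor_le (by have := hnn y; positivity)
        _ = M * m / m := by rw [← Finset.sum_div, ← Finset.mul_sum]; rfl
        _ = M := mul_div_cancel_right₀ _ hmpos.ne'
    rw [← Nat.cast_sum] at h
    exact Nat.cast_le.1 h)
  refine le_trans ?_ (fid_push_le_FD (unif α) Q W)
  have hterm (y : β) : Real.sqrt ((1 - s⁻¹) / m) * q y ≤ Real.sqrt (push W (unif α) y * Q y) := by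
    by_cases hy : s / M ≤ Q y
    · have hq : q y = Q y := if_pos hy
      rw [hq]
      apply Real.le_sqrt_of_sq_le
      rw [mul_pow, Real.sq_sqrt (by positivity), sq (Q y), ← mul_assoc]
      refine mul_le_mul_of_nonneg_right (le_trans ?_ (hW y)) (hQ.1 y)
      have h1 := (Nat.sub_one_lt_floor (M * q y / m)).le
      rw [hq] at h1 ⊢
      have h2 : s ≤ M * Q y / m := by
        rw [le_div_iff₀ hmpos]
        rw [div_le_iff₀ hM] at hy
        nlinarith
      have h3 : 1 ≤ s⁻¹ * (M * Q y / m) := by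
        rw [← div_eq_inv_mul, le_div_iff₀ hs0, one_mul]
        exact h2
      rw [← div_eq_mul_inv, le_div_iff₀ hM]
      refine le_trans (le_of_eq ?_) (le_trans (by linarith : (1 - s⁻¹) * (M * Q y / m) ≤
        M * Q y / m - 1) h1)
      ring
    · simp [q, hy]
  calc Real.sqrt ((1 - s⁻¹) * m) = Real.sqrt ((1 - s⁻¹) / m) * m := by
        rw [← Real.sqrt_sq hm0, ← Real.sqrt_mul (by positivity), Real.sqrt_sq hm0]
        congr 1
        field_simp
    _ = ∑ y, Real.sqrt ((1 - s⁻¹) / m) * q y := by rw [← Finset.mul_sum]; rfl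
    _ ≤ _ := Finset.sum_le_sum fun y _ => hterm y

lemma iid_U2 (n : ℕ) : iid U2 n = unif (Fin n → Fin 2) := by
  funext f
  simp [iid, U2, unif]

lemma H2_pos [Fintype α] {P : α → ℝ} (hP : IsProb P) (hV : 0 < V2 P) : 0 < H2 P := by
  have hle (x : α) : P x ≤ 1 :=
    (Finset.single_le_sum (fun y _ => hP.1 y) (Finset.mem_univ x)).trans_eq hP.2
  have hnn (x : α) : 0 ≤ -(P x * Real.logb 2 (P x)) := by
    have := Real.logb_nonpos one_lt_two (hP.1 x) (hle x)
    nlinarith [hP.1 x]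
  refine (Finset.sum_nonneg fun x _ => hnn x).lt_of_ne fun h => hV.ne' ?_
  have hz := (Finset.sum_eq_zero_iff_of_nonneg fun x _ => hnn x).1 h.symm
  have hH : H2 P = 0 := h.symm
  refine Finset.sum_eq_zero fun x hx => ?_
  rw [hH, sub_zero, neg_sq, sq, ← mul_assoc, neg_eq_zero.1 (hz x hx), zero_mul]

/-- The standardized information content `(-log₂ P(x) - H(P)) / √V(P)`. -/
noncomputable def stdInfo [Fintype α] (P : α → ℝ) (x : α) : ℝ :=
  (-Real.logb 2 (P x) - H2 P) / Real.sqrt (V2 P)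

lemma sum_mul_stdInfo [Fintype α] {P : α → ℝ} (hP : IsProb P) : ∑ x, P x * stdInfo P x = 0 := by
  unfold stdInfo
  simp_rw [mul_div_assoc', ← Finset.sum_div, mul_sub, Finset.sum_sub_distrib, ← Finset.sum_mul,
    hP.2, mul_neg]
  simp [H2]

lemma sum_mul_stdInfo_sq [Fintype α] {P : α → ℝ} (hV : 0 < V2 P) :
    ∑ x, P x * stdInfo P x ^ 2 = 1 := by
  unfold stdInfo
  simp_rw [div_pow, Real.sq_sqrt hV.le, mul_div_assoc', ← Finset.sum_div]
  exact div_self hV.ne'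

open Classical in
lemma massAbove_iid [Fintype α] {P : α → ℝ} (hP : IsProb P) (hV : 0 < V2 P) {L : ℕ} (hL : 0 < L)
    {θ : ℝ} (hθ : 0 < θ) :
    massAbove (iid P L) θ = ∑ f : Fin L → α,
      if (Real.sqrt L)⁻¹ * ∑ i, stdInfo P (f i) ≤
          (-Real.logb 2 θ - L * H2 P) / (Real.sqrt L * Real.sqrt (V2 P))
        then iid P L f else 0 := by
  refine Finset.sum_congr rfl fun f _ => ?_
  rcases ((iid_isProb hP L).1 f).eq_or_lt with h0 | hpos
  · simp [← h0]
  refine if_congr ?_ rfl rfl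
  have hPf (i : Fin L) : P (f i) ≠ 0 := fun h =>
    hpos.ne' (Finset.prod_eq_zero (Finset.mem_univ i) h)
  have hlog : Real.logb 2 (iid P L f) = ∑ i, Real.logb 2 (P (f i)) :=
    Real.logb_prod _ _ fun i _ => hPf i
  have hsL : 0 < Real.sqrt L := Real.sqrt_pos.2 (by exact_mod_cast hL)
  have hsV : 0 < Real.sqrt (V2 P) := Real.sqrt_pos.2 hV
  have hsum : (Real.sqrt L)⁻¹ * ∑ i, stdInfo P (f i) =
      (-Real.logb 2 (iid P L f) - L * H2 P) / (Real.sqrt L * Real.sqrt (V2 P)) := by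
    unfold stdInfo
    rw [hlog, ← Finset.sum_div, Finset.sum_sub_distrib, Finset.sum_neg_distrib]
    simp only [Finset.sum_const, Finset.card_univ, Fintype.card_fin, nsmul_eq_mul]
    field_simp
  rw [hsum, div_le_div_iff_of_pos_right (by positivity), ← Real.logb_le_logb one_lt_two hθ hpos]
  constructor <;> intro h <;> linarith

lemma tendsto_sqrt_nat : Tendsto (fun n : ℕ => Real.sqrt n) atTop atTop :=
  Real.tendsto_sqrt_atTop.comp tendsto_natCast_atTop_atTop

lemma tendsto_floor_sub_div_sqrt {a : ℝ} (ha : 0 < a) (b : ℝ) :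
    Tendsto (fun n : ℕ => ((⌊a * n + b * Real.sqrt n⌋₊ : ℝ) - a * n) / Real.sqrt n) atTop
      (𝓝 b) := by
  have hinv : Tendsto (fun n : ℕ => (Real.sqrt n)⁻¹) atTop (𝓝 0) :=
    tendsto_inv_atTop_zero.comp tendsto_sqrt_nat
  have hlow : Tendsto (fun n : ℕ => b - (Real.sqrt n)⁻¹) atTop (𝓝 b) := by
    simpa using tendsto_const_nhds.sub hinv
  have hpos : ∀ᶠ n : ℕ in atTop, 0 < Real.sqrt n ∧ 0 ≤ a * n + b * Real.sqrt n := by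
    filter_upwards [tendsto_sqrt_nat.eventually_gt_atTop 0,
      tendsto_sqrt_nat.eventually_ge_atTop (-b / a)] with n h1 h2
    refine ⟨h1, ?_⟩
    rw [div_le_iff₀ ha] at h2
    nlinarith [Real.sq_sqrt (Nat.cast_nonneg (α := ℝ) n)]
  refine tendsto_of_tendsto_of_tendsto_of_le_of_le' hlow tendsto_const_nhds ?_ ?_
  · filter_upwards [hpos] with n ⟨h1, h2⟩
    rw [le_div_iff₀ h1, sub_mul, inv_mul_cancel₀ h1.ne']
    linarith [Nat.sub_one_lt_floor (a * n + b * Real.sqrt n)]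
  · filter_upwards [hpos] with n ⟨h1, h2⟩
    rw [div_le_iff₀ h1]
    linarith [Nat.floor_le h2]

lemma tendsto_massAbove_iid [Fintype α] {P : α → ℝ} (hP : IsProb P) (hV : 0 < V2 P) (b : ℝ)
    {θ : ℕ → ℝ} (hθ : ∀ᶠ n in atTop, 0 < θ n)
    (hlim : Tendsto (fun n : ℕ => (-Real.logb 2 (θ n) - n) / Real.sqrt n) atTop (𝓝 0)) :
    Tendsto (fun n : ℕ => massAbove (iid P ⌊(H2 P)⁻¹ * n + b * Real.sqrt n⌋₊) (θ n)) atTop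
      (𝓝 (stdG (-(H2 P ^ ((3 : ℝ) / 2) * b) / Real.sqrt (V2 P)))) := by
  have hH := H2_pos hP hV
  have ha : 0 < (H2 P)⁻¹ := inv_pos.2 hH
  set L : ℕ → ℕ := fun n => ⌊(H2 P)⁻¹ * n + b * Real.sqrt n⌋₊
  have hfl : Tendsto (fun n : ℕ => ((L n : ℝ) - (H2 P)⁻¹ * n) / Real.sqrt n) atTop (𝓝 b) :=
    tendsto_floor_sub_div_sqrt ha b
  have hinv : Tendsto (fun n : ℕ => (Real.sqrt n)⁻¹) atTop (𝓝 0) :=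
    tendsto_inv_atTop_zero.comp tendsto_sqrt_nat
  have hratio : Tendsto (fun n : ℕ => (L n : ℝ) / n) atTop (𝓝 (H2 P)⁻¹) := by
    have h := (hfl.mul hinv).add_const (H2 P)⁻¹
    rw [mul_zero, zero_add] at h
    refine h.congr' ?_
    filter_upwards [eventually_gt_atTop 0] with n hn
    have hn' : (0 : ℝ) < n := by exact_mod_cast hn
    rw [← div_eq_mul_inv, div_div, Real.mul_self_sqrt hn'.le, sub_div,
      mul_div_cancel_right₀ _ hn'.ne', sub_add_cancel]
  have hL : Tendsto L atTop atTop := by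
    have h := hratio.pos_mul_atTop ha tendsto_natCast_atTop_atTop
    refine tendsto_natCast_atTop_iff.1 (h.congr' ?_)
    filter_upwards [eventually_gt_atTop 0] with n hn
    have hn' : (n : ℝ) ≠ 0 := by exact_mod_cast hn.ne'
    exact div_mul_cancel₀ _ hn'
  have hsV : 0 < Real.sqrt (V2 P) := Real.sqrt_pos.2 hV
  have ht : Tendsto (fun n : ℕ => (-Real.logb 2 (θ n) - L n * H2 P) /
      (Real.sqrt (L n) * Real.sqrt (V2 P))) atTop
      (𝓝 (-(H2 P ^ ((3 : ℝ) / 2) * b) / Real.sqrt (V2 P))) := by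
    have hsa : 0 < Real.sqrt (H2 P)⁻¹ := Real.sqrt_pos.2 ha
    have h := (hlim.sub (hfl.const_mul (H2 P))).div
      ((Real.continuous_sqrt.continuousAt.tendsto.comp hratio).mul_const (Real.sqrt (V2 P)))
      (mul_pos hsa hsV).ne'
    have hval : (0 - H2 P * b) / (Real.sqrt (H2 P)⁻¹ * Real.sqrt (V2 P)) =
        -(H2 P ^ ((3 : ℝ) / 2) * b) / Real.sqrt (V2 P) := by
      have h32 : H2 P ^ ((3 : ℝ) / 2) = H2 P * Real.sqrt (H2 P) := by
        rw [show (3 : ℝ) / 2 = 1 + 1 / 2 by norm_num, Real.rpow_add hH, Real.rpow_one,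
          Real.sqrt_eq_rpow]
      have hsH : 0 < Real.sqrt (H2 P) := Real.sqrt_pos.2 hH
      rw [h32, Real.sqrt_inv]
      field_simp
      ring
    rw [hval] at h
    refine h.congr' ?_
    filter_upwards [eventually_gt_atTop 0] with n hn
    have hn' : (0 : ℝ) < n := by exact_mod_cast hn
    have hsn : 0 < Real.sqrt n := Real.sqrt_pos.2 hn'
    simp only [Pi.div_apply, Function.comp_apply]
    rw [Real.sqrt_div (Nat.cast_nonneg _)]
    field_simp
    ring
  have key := tendsto_iid_sum_le hP (sum_mul_stdInfo hP) (sum_mul_stdInfo_sq hV) hL ht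
  refine key.congr' ?_
  filter_upwards [hθ, hL.eventually_gt_atTop 0] with n h1 h2
  exact (massAbove_iid hP hV h2 h1).symm

lemma tendsto_logb_div_sqrt : Tendsto (fun n : ℕ => Real.logb 2 n / Real.sqrt n) atTop (𝓝 0) := by
  have h := ((isLittleO_log_rpow_atTop (r := 1 / 2) (by norm_num)).tendsto_div_nhds_zero.comp
    (tendsto_natCast_atTop_atTop (R := ℝ))).div_const (Real.log 2)
  rw [zero_div] at h
  refine h.congr fun n => ?_
  simp only [Function.comp_apply, Real.logb, Real.sqrt_eq_rpow]
  ring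

/-- second order asymptotics of the resolvability problem
(entropy and varentropy in base 2). -/
theorem second_order_uniform_source {X : Type*} [Fintype X]
    (P : X → ℝ) (hP : IsProb P) (hV : 0 < V2 P) (b : ℝ) :
    Tendsto (fun n : ℕ =>
        FD (iid U2 n) (iid P ⌊(H2 P)⁻¹ * n + b * Real.sqrt n⌋₊)) atTop
      (nhds (Real.sqrt (stdG (-(H2 P ^ ((3 : ℝ) / 2) * b) / Real.sqrt (V2 P))))) ∧
    Tendsto (fun n : ℕ =>
        FM (iid U2 n) (iid P ⌊(H2 P)⁻¹ * n + b * Real.sqrt n⌋₊)) atTop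
      (nhds (Real.sqrt (stdG (-(H2 P ^ ((3 : ℝ) / 2) * b) / Real.sqrt (V2 P))))) := by
  have hcard (n : ℕ) : (Fintype.card (Fin n → Fin 2) : ℝ) = 2 ^ n := by simp
  have hQ (L : ℕ) : IsProb (iid P L) := iid_isProb hP L
  set g := stdG (-(H2 P ^ ((3 : ℝ) / 2) * b) / Real.sqrt (V2 P))
  set Q := fun n : ℕ => iid P ⌊(H2 P)⁻¹ * n + b * Real.sqrt n⌋₊
  have hninv : Tendsto (fun n : ℕ => (n : ℝ)⁻¹) atTop (𝓝 0) := tendsto_inv_atTop_nhds_zero_nat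
  have hlogpow (n : ℕ) : Real.logb 2 ((2 : ℝ) ^ n) = n := by
    rw [Real.logb_pow, Real.logb_self_eq_one one_lt_two, mul_one]
  have hlow : Tendsto (fun n : ℕ => Real.sqrt ((1 - (n : ℝ)⁻¹) * massAbove (Q n) (n / 2 ^ n)))
      atTop (𝓝 (Real.sqrt g)) := by
    have h := tendsto_massAbove_iid hP hV b (θ := fun n : ℕ => n / 2 ^ n)
      (by filter_upwards [eventually_gt_atTop 0] with n hn; positivity) (by
        have h := tendsto_logb_div_sqrt.neg
        rw [neg_zero] at h
        refine h.congr' ?_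
        filter_upwards [eventually_gt_atTop 0] with n hn
        rw [Real.logb_div (by positivity) (by positivity), hlogpow]
        ring)
    have h' := (hninv.const_sub 1).mul h
    rw [sub_zero, one_mul] at h'
    exact (Real.continuous_sqrt.tendsto _).comp h'
  have hup : Tendsto (fun n : ℕ =>
      Real.sqrt (massAbove (Q n) ((2 ^ n)⁻¹ * (n : ℝ)⁻¹) + (n : ℝ)⁻¹))
      atTop (𝓝 (Real.sqrt g)) := by
    have h := tendsto_massAbove_iid hP hV b (θ := fun n : ℕ => (2 ^ n)⁻¹ * (n : ℝ)⁻¹)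
      (by filter_upwards [eventually_gt_atTop 0] with n hn; positivity) (by
        refine tendsto_logb_div_sqrt.congr' ?_
        filter_upwards [eventually_gt_atTop 0] with n hn
        rw [Real.logb_mul (by positivity) (by positivity), Real.logb_inv, Real.logb_inv, hlogpow]
        ring)
    have h' := h.add hninv
    rw [add_zero] at h'
    exact (Real.continuous_sqrt.tendsto _).comp h'
  have h1 : ∀ᶠ n : ℕ in atTop,
      Real.sqrt ((1 - (n : ℝ)⁻¹) * massAbove (Q n) (n / 2 ^ n)) ≤ FD (iid U2 n) (Q n) := by
    filter_upwards [eventually_gt_atTop 0] with n hn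
    have h := le_FD_unif (α := Fin n → Fin 2) (hQ ⌊(H2 P)⁻¹ * n + b * Real.sqrt n⌋₊)
      (s := n) (by exact_mod_cast hn)
    rwa [hcard, ← iid_U2] at h
  have h2 (n : ℕ) : FD (iid U2 n) (Q n) ≤ FM (iid U2 n) (Q n) := by
    rw [iid_U2]
    exact FD_unif_le_FM (hQ _)
  have h3 (n : ℕ) : FM (iid U2 n) (Q n) ≤
      Real.sqrt (massAbove (Q n) ((2 ^ n)⁻¹ * (n : ℝ)⁻¹) + (n : ℝ)⁻¹) := by
    have h := FM_unif_le (α := Fin n → Fin 2) (hQ ⌊(H2 P)⁻¹ * n + b * Real.sqrt n⌋₊)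
      (θ := (2 ^ n)⁻¹ * (n : ℝ)⁻¹) (by positivity)
    rwa [hcard, mul_inv_cancel_left₀ (by positivity), ← iid_U2] at h
  exact ⟨tendsto_of_tendsto_of_tendsto_of_le_of_le' hlow hup h1
      (Eventually.of_forall fun n => (h2 n).trans (h3 n)),
    tendsto_of_tendsto_of_tendsto_of_le_of_le' hlow hup (h1.mono fun n h => h.trans (h2 n))
      (Eventually.of_forall h3)⟩

end RNG
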